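/- General error-function identity: let v₁,…,vₙ span a positive definite n-dimensional subspace of ℝᵈ and x ∈ ℝᵈ. Then Φₙᴱ(v₁,…,v_{n−1}, vₙ+v_{n−1}; x) + Φₙᴱ(v₁,…,v_{n−2}, v_{n−1}+vₙ, vₙ; x) − Φₙᴱ(v₁,…,vₙ; x) = Φ_{n−2}ᴱ(v₁,…,v_{n−2}; x). -/

import Mathlib

open MeasureTheory Matrix
open scoped Classical

/-- The sign function with the convention `sgn 0 = 0`. -/
noncomputable def sgn (x : ℝ) : ℝ := if 0 < x then 1 else if x < 0 then -1 else 0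

/-- The indicator function of `0`. -/
noncomputable def delta (x : ℝ) : ℝ := if x = 0 then 1 else 0

/-- The boosted generalized error function `Φₙᴱ({vᵢ};x)`, in its integral representation:
with `X` the Gram matrix `Xᵢⱼ = vᵢ·G·vⱼ` of the vectors `vᵢ` with respect to the bilinear
form given by `G`,
`Φₙᴱ({vᵢ};x) = (det X)^{−1/2} ∫ e^{−π (c−u)ᵀ X⁻¹ (c−u)} ∏ᵢ sgn(uᵢ) du`,
where `cᵢ = vᵢ·G·x`.  For the empty family this equals `1` (the convention `Φ₀ᴱ = 1`). -/
noncomputable def PhiE {d : ℕ} (G : Matrix (Fin d) (Fin d) ℝ)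
    {ι : Type} [Fintype ι] (v : ι → Fin d → ℝ) (x : Fin d → ℝ) : ℝ :=
  (Matrix.of fun i j : ι => v i ⬝ᵥ G.mulVec (v j)).det ^ (-(1:ℝ)/2) *
    ∫ u : ι → ℝ,
      Real.exp (-Real.pi *
        (((fun i => v i ⬝ᵥ G.mulVec x) - u) ⬝ᵥ
          (Matrix.of fun i j : ι => v i ⬝ᵥ G.mulVec (v j))⁻¹.mulVec
            ((fun i => v i ⬝ᵥ G.mulVec x) - u))) *
      ∏ i, sgn (u i)

/-- The mean of `f` against the Gaussian density centred at `c` with covariance proportional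
to `A`. -/
noncomputable def gaussMean {ι : Type*} [Fintype ι] [DecidableEq ι] (A : Matrix ι ι ℝ)
    (c : ι → ℝ) (f : (ι → ℝ) → ℝ) : ℝ :=
  A.det ^ (-(1 : ℝ) / 2) *
    ∫ u : ι → ℝ, Real.exp (-Real.pi * ((c - u) ⬝ᵥ A⁻¹ *ᵥ (c - u))) * f u

section GaussMean

variable {ι κ τ : Type*} [Fintype ι] [DecidableEq ι] [Fintype κ] [DecidableEq κ]
  [Fintype τ] [DecidableEq τ]

lemma integral_mulVec {L : Matrix ι ι ℝ} (hL : L.det ≠ 0) (g : (ι → ℝ) → ℝ) :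
    ∫ u, g (L *ᵥ u) = |L.det|⁻¹ * ∫ u, g u := by
  have hemb : MeasurableEmbedding (L.toLin' : (ι → ℝ) → ι → ℝ) := by
    have hinj : Function.Injective L.mulVec := by
      simpa [Matrix.mulVec_injective_iff_isUnit, Matrix.isUnit_iff_isUnit_det] using hL
    exact (LinearMap.continuous_of_finiteDimensional _).measurableEmbedding hinj
  have h := hemb.integral_map (μ := volume) g
  rw [Real.map_matrix_volume_pi_eq_smul_volume_pi hL, integral_smul_measure] at h
  simp only [toLin'_apply] at h
  rw [← h, ENNReal.toReal_ofReal (abs_nonneg _), abs_inv, smul_eq_mul]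

lemma gaussMean_conj {A L : Matrix ι ι ℝ} (hA : 0 ≤ A.det) (hL : L.det ≠ 0) (c : ι → ℝ)
    (f : (ι → ℝ) → ℝ) :
    gaussMean (L * A * Lᵀ) (L *ᵥ c) f = gaussMean A c fun u => f (L *ᵥ u) := by
  have hLu : IsUnit L.det := hL.isUnit
  have key : ∀ z : ι → ℝ, (L *ᵥ z) ⬝ᵥ (L * A * Lᵀ)⁻¹ *ᵥ (L *ᵥ z) = z ⬝ᵥ A⁻¹ *ᵥ z := by
    intro z
    have hinv : (L * A * Lᵀ)⁻¹ *ᵥ (L *ᵥ z) = Lᵀ⁻¹ *ᵥ (A⁻¹ *ᵥ z) := by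
      rw [Matrix.mul_inv_rev, Matrix.mul_inv_rev, Matrix.mulVec_mulVec, Matrix.mulVec_mulVec,
        Matrix.mul_assoc, Matrix.mul_assoc, Matrix.nonsing_inv_mul L hLu, Matrix.mul_one]
    rw [hinv, ← Matrix.vecMul_transpose, ← Matrix.dotProduct_mulVec, Matrix.mulVec_mulVec,
      Matrix.mul_nonsing_inv _ (by simpa using hLu), Matrix.one_mulVec]
  have h := integral_mulVec hL fun w =>
    Real.exp (-Real.pi * ((L *ᵥ c - w) ⬝ᵥ (L * A * Lᵀ)⁻¹ *ᵥ (L *ᵥ c - w))) * f w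
  simp only [← Matrix.mulVec_sub, key] at h
  have hdet : (L * A * Lᵀ).det ^ (-(1 : ℝ) / 2) = |L.det|⁻¹ * A.det ^ (-(1 : ℝ) / 2) := by
    have : (L * A * Lᵀ).det = |L.det| ^ 2 * A.det := by
      rw [Matrix.det_mul, Matrix.det_mul, Matrix.det_transpose, sq_abs]; ring
    rw [this, Real.mul_rpow (by positivity) hA, ← Real.rpow_natCast, ← Real.rpow_mul (abs_nonneg _),
      ← Real.rpow_neg_one]
    norm_num
  rw [gaussMean, gaussMean, h, hdet]
  ring

lemma gaussMean_submatrix (e : κ ≃ ι) (A : Matrix ι ι ℝ) (c : ι → ℝ) (f : (κ → ℝ) → ℝ) :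
    gaussMean (A.submatrix e e) (c ∘ e) f = gaussMean A c fun u => f (u ∘ e) := by
  have h := (volume_measurePreserving_piCongrLeft (fun _ : ι => ℝ) e).symm.integral_comp'
    fun w : κ → ℝ => Real.exp (-Real.pi *
      ((c ∘ e - w) ⬝ᵥ (A.submatrix e e)⁻¹ *ᵥ (c ∘ e - w))) * f w
  rw [gaussMean, gaussMean, Matrix.det_submatrix_equiv_self, ← h]
  congr 2
  funext u
  have hu : (MeasurableEquiv.piCongrLeft (fun _ : ι => ℝ) e).symm u = u ∘ e := rfl
  have hsub : c ∘ e - u ∘ e = (c - u) ∘ e := rfl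
  rw [hu, hsub, Matrix.inv_submatrix_equiv, Matrix.submatrix_mulVec_equiv]
  simp [Function.comp_assoc, comp_equiv_dotProduct_comp_equiv]

lemma gaussMean_one_one (c : ι → ℝ) : gaussMean (1 : Matrix ι ι ℝ) c (fun _ => 1) = 1 := by
  have h : ∀ u : ι → ℝ, Real.exp (-Real.pi * ((c - u) ⬝ᵥ (c - u))) =
      ∏ i, Real.exp (-Real.pi * (c i - u i) ^ 2) := by
    intro u
    rw [← Real.exp_sum, dotProduct, Finset.mul_sum]
    simp [sq]
  have h1 : ∀ a : ℝ, ∫ t : ℝ, Real.exp (-Real.pi * (a - t) ^ 2) = 1 := by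
    intro a
    rw [integral_sub_left_eq_self (fun t => Real.exp (-Real.pi * t ^ 2)), integral_gaussian]
    simp [Real.pi_ne_zero]
  simp only [gaussMean, inv_one, one_mulVec, mul_one, h, det_one, Real.one_rpow, one_mul]
  rw [integral_fintype_prod_volume_eq_prod fun i t => Real.exp (-Real.pi * (c i - t) ^ 2)]
  exact Finset.prod_eq_one fun i _ => h1 (c i)

open scoped MatrixOrder Matrix.Norms.L2Operator in
lemma gaussMean_one {A : Matrix ι ι ℝ} (hA : A.PosDef) (c : ι → ℝ) :
    gaussMean A c (fun _ => 1) = 1 := by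
  obtain ⟨B, rfl⟩ := CStarAlgebra.nonneg_iff_eq_star_mul_self.mp hA.posSemidef.nonneg
  have hB : B.det ≠ 0 := by
    intro h0
    simpa [h0] using hA.det_pos.ne'
  have h := gaussMean_conj (A := 1) (L := Bᵀ) (by simp) (by simpa using hB) (Bᵀ⁻¹ *ᵥ c)
    (fun _ => 1)
  rw [gaussMean_one_one, Matrix.mul_one, Matrix.transpose_transpose, Matrix.mulVec_mulVec,
    Matrix.mul_nonsing_inv _ (by simpa using hB), Matrix.one_mulVec] at h
  simpa [star_eq_conjTranspose] using h

lemma integrable_gauss {A : Matrix ι ι ℝ} (hA : A.PosDef) (c : ι → ℝ) :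
    Integrable fun u : ι → ℝ => Real.exp (-Real.pi * ((c - u) ⬝ᵥ A⁻¹ *ᵥ (c - u))) := by
  by_contra hn
  have h := gaussMean_one hA c
  simp only [gaussMean, mul_one, integral_undef hn, mul_zero, zero_ne_one] at h

lemma gaussMean_fromBlocks_diag {A : Matrix κ κ ℝ} {S : Matrix τ τ ℝ} (hA : A.PosDef)
    (hS : S.PosDef) (c : κ ⊕ τ → ℝ) (g : (κ → ℝ) → ℝ) :
    gaussMean (fromBlocks A 0 0 S) c (fun u => g (u ∘ Sum.inl)) =
      gaussMean A (c ∘ Sum.inl) g := by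
  have hinv : (fromBlocks A 0 0 S)⁻¹ = fromBlocks A⁻¹ 0 0 S⁻¹ := by
    rw [inv_fromBlocks_zero₁₂_of_isUnit_iff _ _ _ (by simp [hA.isUnit, hS.isUnit])]
    simp
  have h := (volume_measurePreserving_sumPiEquivProdPi (fun _ : κ ⊕ τ => ℝ)).integral_comp'
    fun w : (κ → ℝ) × (τ → ℝ) =>
      (Real.exp (-Real.pi * ((c ∘ Sum.inl - w.1) ⬝ᵥ A⁻¹ *ᵥ (c ∘ Sum.inl - w.1))) * g w.1) *
      (Real.exp (-Real.pi * ((c ∘ Sum.inr - w.2) ⬝ᵥ S⁻¹ *ᵥ (c ∘ Sum.inr - w.2))) * 1)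
  have hu : ∀ u : κ ⊕ τ → ℝ, MeasurableEquiv.sumPiEquivProdPi (fun _ : κ ⊕ τ => ℝ) u =
      (u ∘ Sum.inl, u ∘ Sum.inr) := fun _ => rfl
  have hexp : ∀ u : κ ⊕ τ → ℝ,
      Real.exp (-Real.pi * ((c - u) ⬝ᵥ (fromBlocks A 0 0 S)⁻¹ *ᵥ (c - u))) *
        g (u ∘ Sum.inl) =
      (Real.exp (-Real.pi * ((c ∘ Sum.inl - u ∘ Sum.inl) ⬝ᵥ
        A⁻¹ *ᵥ (c ∘ Sum.inl - u ∘ Sum.inl))) * g (u ∘ Sum.inl)) *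
      (Real.exp (-Real.pi * ((c ∘ Sum.inr - u ∘ Sum.inr) ⬝ᵥ
        S⁻¹ *ᵥ (c ∘ Sum.inr - u ∘ Sum.inr))) * 1) := by
    intro u
    have hl : (c - u) ∘ Sum.inl = c ∘ Sum.inl - u ∘ Sum.inl := rfl
    have hr : (c - u) ∘ Sum.inr = c ∘ Sum.inr - u ∘ Sum.inr := rfl
    rw [hinv, ← Sum.elim_comp_inl_inr (c - u), fromBlocks_mulVec, hl, hr]
    simp only [Sum.elim_comp_inl, Sum.elim_comp_inr, zero_mulVec, add_zero, zero_add,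
      sumElim_dotProduct_sumElim, mul_add, Real.exp_add]
    ring
  have hone := gaussMean_one hS (c ∘ Sum.inr)
  simp only [hu] at h
  simp only [gaussMean] at hone ⊢
  simp only [hexp]
  have hprod := integral_prod_mul (μ := (volume : Measure (κ → ℝ)))
    (ν := (volume : Measure (τ → ℝ)))
    (fun w => Real.exp (-Real.pi * ((c ∘ Sum.inl - w) ⬝ᵥ A⁻¹ *ᵥ (c ∘ Sum.inl - w))) * g w)
    (fun w => Real.exp (-Real.pi * ((c ∘ Sum.inr - w) ⬝ᵥ S⁻¹ *ᵥ (c ∘ Sum.inr - w))) * 1)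
  rw [h, Measure.volume_eq_prod, hprod, det_fromBlocks_zero₁₂,
    Real.mul_rpow hA.det_pos.le hS.det_pos.le]
  linear_combination (A.det ^ (-(1 : ℝ) / 2) * ∫ u : κ → ℝ, Real.exp (-Real.pi *
    ((c ∘ Sum.inl - u) ⬝ᵥ A⁻¹ *ᵥ (c ∘ Sum.inl - u))) * g u) * hone

/-- Gaussian means of functions of the first block of variables only involve the first block
of the covariance. -/
lemma gaussMean_marginal {X : Matrix (κ ⊕ τ) (κ ⊕ τ) ℝ} (hX : X.PosDef) (c : κ ⊕ τ → ℝ)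
    (g : (κ → ℝ) → ℝ) :
    gaussMean X c (fun u => g (u ∘ Sum.inl)) =
      gaussMean (X.submatrix Sum.inl Sum.inl) (c ∘ Sum.inl) g := by
  have hA : (X.submatrix Sum.inl Sum.inl : Matrix κ κ ℝ).PosDef :=
    hX.submatrix Sum.inl_injective
  set A : Matrix κ κ ℝ := X.submatrix Sum.inl Sum.inl
  set C : Matrix τ κ ℝ := X.submatrix Sum.inr Sum.inl with hC
  set D : Matrix τ τ ℝ := X.submatrix Sum.inr Sum.inr
  have hXt : Xᵀ = X := by simpa using hX.isHermitian.eq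
  have hAt : Aᵀ = A := by simpa using hA.isHermitian.eq
  have hXb : X = fromBlocks A Cᵀ C D := by
    rw [hC, transpose_submatrix, hXt]
    exact (fromBlocks_toBlocks X).symm
  have hAu : IsUnit A.det := hA.det_pos.ne'.isUnit
  set L : Matrix (κ ⊕ τ) (κ ⊕ τ) ℝ := fromBlocks 1 0 (-(C * A⁻¹)) 1 with hL
  have hLdet : L.det = 1 := by simp [hL]
  have hLXL : L * X * Lᵀ = fromBlocks A 0 0 (D - C * A⁻¹ * Cᵀ) := by
    rw [hXb, hL, fromBlocks_transpose, fromBlocks_multiply, fromBlocks_multiply]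
    have h1 : C * A⁻¹ * A = C := by
      rw [Matrix.mul_assoc, Matrix.nonsing_inv_mul _ hAu, Matrix.mul_one]
    have h2 : A * (A⁻¹ * Cᵀ) = Cᵀ := by
      rw [← Matrix.mul_assoc, Matrix.mul_nonsing_inv _ hAu, Matrix.one_mul]
    congr 1 <;> simp [h1, h2, hAt, Matrix.transpose_nonsing_inv, sub_eq_neg_add]
  have hpos : (fromBlocks A 0 0 (D - C * A⁻¹ * Cᵀ)).PosDef := by
    rw [← hLXL]
    have hLu : IsUnit L := (Matrix.isUnit_iff_isUnit_det _).mpr (by simp [hLdet])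
    simpa [star_eq_conjTranspose] using (Matrix.IsUnit.posDef_star_right_conjugate_iff hLu).mpr hX
  have hS : (D - C * A⁻¹ * Cᵀ).PosDef := hpos.submatrix (e := Sum.inr) Sum.inr_injective
  have hLl : ∀ u : κ ⊕ τ → ℝ, (L *ᵥ u) ∘ Sum.inl = u ∘ Sum.inl := by
    intro u
    rw [hL, fromBlocks_mulVec]
    simp
  have h := gaussMean_conj hX.det_pos.le (by simp [hLdet] : L.det ≠ 0) c
    (fun u => g (u ∘ Sum.inl))
  simp only [hLXL, hLl] at h
  rw [← h, gaussMean_fromBlocks_diag hA hS, hLl]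

end GaussMean

lemma measurable_sgn : Measurable sgn :=
  Measurable.ite measurableSet_Ioi measurable_const
    (Measurable.ite measurableSet_Iio measurable_const measurable_const)

lemma abs_sgn_le_one (a : ℝ) : |sgn a| ≤ 1 := by
  unfold sgn; split_ifs <;> simp

lemma sgn_add_identity {a b : ℝ} (ha : a ≠ 0) (hb : b ≠ 0) :
    sgn a * sgn (b + a) + sgn (a + b) * sgn b - sgn a * sgn b = 1 := by
  unfold sgn
  rcases ha.lt_or_gt with ha | ha <;> rcases hb.lt_or_gt with hb | hb <;>
    split_ifs <;> linarith

lemma integrable_gauss_mul_prod_sgn {ι : Type*} [Fintype ι] [DecidableEq ι] {A : Matrix ι ι ℝ}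
    (hA : A.PosDef) (c : ι → ℝ) (L : Matrix ι ι ℝ) :
    Integrable fun u : ι → ℝ => Real.exp (-Real.pi * ((c - u) ⬝ᵥ A⁻¹ *ᵥ (c - u))) *
      ∏ i, sgn ((L *ᵥ u) i) := by
  refine (integrable_gauss hA c).mul_bdd (c := 1) ?_ (.of_forall fun u => ?_)
  · refine (Finset.measurable_prod _ fun i _ => measurable_sgn.comp ?_).aestronglyMeasurable
    exact (continuous_apply i).measurable.comp
      (Continuous.matrix_mulVec continuous_const continuous_id).measurable
  · rw [Real.norm_eq_abs, Finset.abs_prod]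
    exact Finset.prod_le_one (fun _ _ => abs_nonneg _) fun _ _ => abs_sgn_le_one _

lemma gram_eq {d : ℕ} (G : Matrix (Fin d) (Fin d) ℝ) {ι : Type*} (v : ι → Fin d → ℝ) :
    (Matrix.of fun i j : ι => v i ⬝ᵥ G.mulVec (v j)) = Matrix.of v * G * (Matrix.of v)ᵀ := by
  ext i j
  rw [Matrix.mul_assoc]
  simp [Matrix.mul_apply, Matrix.mulVec, dotProduct]

lemma PhiE_eq_gaussMean {d : ℕ} (G : Matrix (Fin d) (Fin d) ℝ) {ι : Type} [Fintype ι]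
    [DecidableEq ι] (v : ι → Fin d → ℝ) (x : Fin d → ℝ) :
    PhiE G v x = gaussMean (Matrix.of v * G * (Matrix.of v)ᵀ) (Matrix.of v *ᵥ (G *ᵥ x))
      fun u => ∏ i, sgn (u i) := by
  have hc : (fun i => v i ⬝ᵥ G.mulVec x) = Matrix.of v *ᵥ (G *ᵥ x) := rfl
  rw [PhiE, gaussMean, gram_eq, hc]
  congr!

lemma PhiE_eq_gaussMean_of_eq_mul {d : ℕ} (G : Matrix (Fin d) (Fin d) ℝ) {ι : Type} [Fintype ι]
    [DecidableEq ι] {v w : ι → Fin d → ℝ}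
    (hv : (Matrix.of v * G * (Matrix.of v)ᵀ).PosDef) {L : Matrix ι ι ℝ}
    (hL : L.det ≠ 0) (hw : Matrix.of w = L * Matrix.of v) (x : Fin d → ℝ) :
    PhiE G w x = gaussMean (Matrix.of v * G * (Matrix.of v)ᵀ) (Matrix.of v *ᵥ (G *ᵥ x))
      fun u => ∏ i, sgn ((L *ᵥ u) i) := by
  rw [PhiE_eq_gaussMean, hw,
    ← gaussMean_conj hv.det_pos.le hL _ (fun u => ∏ i, sgn (u i)), Matrix.transpose_mul,
    Matrix.mulVec_mulVec (M := L)]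
  simp only [Matrix.mul_assoc]

lemma of_update_eq_transvection_mul {ι m : Type*} [Fintype ι] [DecidableEq ι] (i j : ι)
    (v : ι → m → ℝ) :
    Matrix.of (Function.update v i (v i + v j)) = transvection i j (1 : ℝ) * Matrix.of v := by
  ext k l
  rw [transvection, Matrix.add_mul, Matrix.one_mul]
  by_cases hk : k = i
  · subst hk; simp
  · simp [hk]

lemma transvection_mulVec_eq_update {ι : Type*} [Fintype ι] [DecidableEq ι] (i j : ι)
    (u : ι → ℝ) :
    transvection i j (1 : ℝ) *ᵥ u = Function.update u i (u i + u j) := by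
  ext k
  rw [transvection, Matrix.add_mulVec, Matrix.one_mulVec]
  by_cases hk : k = i
  · subst hk; simp [Matrix.single_mulVec]
  · simp [hk, Matrix.single_mulVec]

/-- General error-function identity: if `v₀,…,v_{n+1}` span a positive definite
`(n+2)`-dimensional subspace of `ℝᵈ` (with respect to the bilinear form given by the
symmetric matrix `G`) and `x ∈ ℝᵈ`, then, writing the family with its last vector
`v_{n+1}` replaced by `v_{n+1} + vₙ`, respectively its next-to-last vector `vₙ`
replaced by `vₙ + v_{n+1}`,
`Φ_{n+2}ᴱ(v₀,…,vₙ, v_{n+1}+vₙ; x) + Φ_{n+2}ᴱ(v₀,…,vₙ+v_{n+1}, v_{n+1}; x)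
  − Φ_{n+2}ᴱ(v₀,…,v_{n+1}; x) = Φₙᴱ(v₀,…,v_{n−1}; x)`. -/
theorem PhiE_general_identity
    (d n : ℕ) (G : Matrix (Fin d) (Fin d) ℝ) (hG : G.IsSymm)
    (v : Fin (n + 2) → Fin d → ℝ) (x : Fin d → ℝ)
    (hpd : (Matrix.of fun i j : Fin (n + 2) => v i ⬝ᵥ G.mulVec (v j)).PosDef) :
    PhiE G
        (Function.update v (Fin.last (n + 1))
          (v (Fin.last (n + 1)) + v ((Fin.last n).castSucc))) x +
      PhiE G
        (Function.update v ((Fin.last n).castSucc)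
          (v ((Fin.last n).castSucc) + v (Fin.last (n + 1)))) x -
      PhiE G v x =
      PhiE G (fun i : Fin n => v i.castSucc.castSucc) x := by
  set p : Fin (n + 2) := (Fin.last n).castSucc with hp
  set q : Fin (n + 2) := Fin.last (n + 1) with hq
  have hpq : p ≠ q := (Fin.castSucc_lt_last _).ne
  rw [gram_eq] at hpd
  have h1 := PhiE_eq_gaussMean_of_eq_mul G hpd (by simp [det_transvection_of_ne _ _ hpq.symm])
    (of_update_eq_transvection_mul q p v) x
  have h2 := PhiE_eq_gaussMean_of_eq_mul G hpd (by simp [det_transvection_of_ne _ _ hpq])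
    (of_update_eq_transvection_mul p q v) x
  have h3 := PhiE_eq_gaussMean_of_eq_mul G hpd (by simp) (Matrix.one_mul (Matrix.of v)).symm x
  set A := Matrix.of v * G * (Matrix.of v)ᵀ
  set c := Matrix.of v *ᵥ (G *ᵥ x)
  have hint := integrable_gauss_mul_prod_sgn hpd c
  let e : Fin n ⊕ Fin 2 ≃ Fin (n + 2) := finSumFinEquiv
  have hmarg : PhiE G (fun i : Fin n => v i.castSucc.castSucc) x =
      gaussMean A c fun u => ∏ i : Fin n, sgn (u i.castSucc.castSucc) := by
    have h4 := gaussMean_marginal (hpd.submatrix e.injective) (c ∘ e)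
      fun w : Fin n → ℝ => ∏ i, sgn (w i)
    rw [gaussMean_submatrix] at h4
    refine (PhiE_eq_gaussMean G _ x).trans ?_
    exact h4.symm
  have hsum : ∀ᵐ u : Fin (n + 2) → ℝ,
      ∏ i, sgn ((transvection q p 1 *ᵥ u) i) + ∏ i, sgn ((transvection p q 1 *ᵥ u) i) -
        ∏ i, sgn (((1 : Matrix (Fin (n + 2)) (Fin (n + 2)) ℝ) *ᵥ u) i) =
      ∏ i : Fin n, sgn (u i.castSucc.castSucc) := by
    filter_upwards [Measure.ae_eval_ne (fun _ => volume) p (0 : ℝ),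
      Measure.ae_eval_ne (fun _ => volume) q (0 : ℝ)] with u hup huq
    have hne : ∀ i : Fin n, i.castSucc.castSucc ≠ p ∧ i.castSucc.castSucc ≠ q := fun i =>
      ⟨fun h => (Fin.castSucc_lt_last i).ne (Fin.castSucc_injective _ h),
        (Fin.castSucc_lt_last _).ne⟩
    simp only [transvection_mulVec_eq_update, Matrix.one_mulVec, Fin.prod_univ_castSucc,
      ← hp, ← hq, Function.update_self, Function.update_of_ne (hne _).1,
      Function.update_of_ne (hne _).2, Function.update_of_ne hpq, Function.update_of_ne hpq.symm]
    linear_combination (∏ i : Fin n, sgn (u i.castSucc.castSucc)) * sgn_add_identity hup huq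
  rw [h1, h2, h3, hmarg]
  simp only [gaussMean]
  rw [← mul_add, ← mul_sub, ← integral_add' (hint _) (hint _),
    ← integral_sub' ((hint _).add (hint _)) (hint _)]
  congr 1
  refine integral_congr_ae ?_
  filter_upwards [hsum] with u hu
  simp only [← hu, Pi.add_apply, Pi.sub_apply]
  ring
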